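/- Let A be a finite-dimensional solvable elementary Leibniz algebra over a perfect field. Then A² is nilpotent. -/

import Mathlib

namespace Leib

variable {K : Type*} [Field K] {A : Type*} [AddCommGroup A] [Module K A]

variable (mul : A →ₗ[K] A →ₗ[K] A)

/-- The (left) Leibniz identity: left multiplication is a derivation. -/
def IsLeibniz : Prop :=
  ∀ x y z : A, mul x (mul y z) = mul (mul x y) z + mul y (mul x z)

/-- The product of two submodules: the span of all products. -/
def prodSM (B C : Submodule K A) : Submodule K A :=
  Submodule.span K {z | ∃ b ∈ B, ∃ c ∈ C, z = mul b c}

/-- A subalgebra: a submodule closed under multiplication. -/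
def IsSubalg (S : Submodule K A) : Prop :=
  ∀ x ∈ S, ∀ y ∈ S, mul x y ∈ S

/-- A (two-sided) ideal. -/
def IsIdeal (B : Submodule K A) : Prop :=
  ∀ a : A, ∀ b ∈ B, mul a b ∈ B ∧ mul b a ∈ B

/-- An abelian subspace: all products vanish. -/
def IsAbelian (B : Submodule K A) : Prop :=
  ∀ x ∈ B, ∀ y ∈ B, mul x y = 0

/-- A minimal ideal. -/
def IsMinIdeal (B : Submodule K A) : Prop :=
  IsIdeal mul B ∧ B ≠ ⊥ ∧ ∀ C : Submodule K A, IsIdeal mul C → C ≤ B → C = ⊥ ∨ C = B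

/-- Lower central series of a subalgebra `B`: `B, B·B, B·(B·B), ...`. -/
def lcsOf (B : Submodule K A) : ℕ → Submodule K A
  | 0 => B
  | n + 1 => prodSM mul B (lcsOf B n)

/-- A nilpotent subalgebra. -/
def IsNilpotentSubalg (B : Submodule K A) : Prop := ∃ n, lcsOf mul B n = ⊥

/-- A nilpotent algebra. -/
def IsNilpotentAlg : Prop := ∃ n, lcsOf mul ⊤ n = ⊥

/-- Derived series of a subalgebra. -/
def derOf (B : Submodule K A) : ℕ → Submodule K A
  | 0 => B
  | n + 1 => prodSM mul (derOf B n) (derOf B n)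

/-- A solvable subalgebra. -/
def IsSolvableSubalg (B : Submodule K A) : Prop := ∃ n, derOf mul B n = ⊥

/-- A solvable algebra. -/
def IsSolvableAlg : Prop := ∃ n, derOf mul ⊤ n = ⊥

/-- A semisimple algebra: no nonzero solvable ideal. -/
def IsSemisimpleAlg : Prop :=
  ∀ B : Submodule K A, IsIdeal mul B → IsSolvableSubalg mul B → B = ⊥

/-- The nilradical: the largest nilpotent ideal (here: the sup of all nilpotent ideals). -/
def nilrad : Submodule K A :=
  sSup {B : Submodule K A | IsIdeal mul B ∧ IsNilpotentSubalg mul B}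

/-- The socle: the sum of all minimal ideals. -/
def socle : Submodule K A := sSup {B : Submodule K A | IsMinIdeal mul B}

/-- The abelian socle: the sum of all abelian minimal ideals. -/
def asocle : Submodule K A :=
  sSup {B : Submodule K A | IsMinIdeal mul B ∧ IsAbelian mul B}

/-- The centralizer of a subspace `W`: elements annihilating `W` on both sides. -/
def centralizer (W : Submodule K A) : Submodule K A where
  carrier := {x | ∀ w ∈ W, mul x w = 0 ∧ mul w x = 0}
  add_mem' := by
    intro a b ha hb w hw
    constructor
    · simp [map_add, (ha w hw).1, (hb w hw).1]
    · simp [map_add, (ha w hw).2, (hb w hw).2]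
  zero_mem' := by intro w hw; simp
  smul_mem' := by
    intro c a ha w hw
    constructor
    · simp [map_smul, (ha w hw).1]
    · simp [map_smul, (ha w hw).2]

/-- The center of the algebra. -/
def center : Submodule K A := centralizer mul ⊤

/-- A maximal (proper) subalgebra of a subalgebra `M`. -/
def IsMaxSubalgIn (M S : Submodule K A) : Prop :=
  S ≤ M ∧ IsSubalg mul S ∧ S ≠ M ∧
    ∀ T : Submodule K A, T ≤ M → IsSubalg mul T → S ≤ T → T = S ∨ T = M

/-- The Frattini subalgebra of `M`: the intersection of its maximal subalgebras
(equal to `M` if there are none). -/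
def frattiniSubalgIn (M : Submodule K A) : Submodule K A :=
  M ⊓ sInf {S : Submodule K A | IsMaxSubalgIn mul M S}

/-- An ideal of the subalgebra `M`. -/
def IsIdealIn (M C : Submodule K A) : Prop :=
  C ≤ M ∧ ∀ x ∈ M, ∀ c ∈ C, mul x c ∈ C ∧ mul c x ∈ C

/-- The Frattini ideal of `M`: the largest ideal of `M` contained in its
Frattini subalgebra. -/
def frattiniIdealIn (M : Submodule K A) : Submodule K A :=
  sSup {C : Submodule K A | IsIdealIn mul M C ∧ C ≤ frattiniSubalgIn mul M}

/-- The Frattini subalgebra of the algebra. -/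
def frattiniSubalg : Submodule K A := frattiniSubalgIn mul ⊤

/-- The Frattini ideal of the algebra. -/
def frattiniIdeal : Submodule K A := frattiniIdealIn mul ⊤

/-- An elementary algebra: every subalgebra has zero Frattini ideal. -/
def IsElementary : Prop :=
  ∀ M : Submodule K A, IsSubalg mul M → frattiniIdealIn mul M = ⊥

/-- The derived subalgebra `A² = A·A`. -/
def derivedSubalg : Submodule K A := prodSM mul ⊤ ⊤

/-- A Cartan subalgebra: a nilpotent, self-normalizing subalgebra. -/
def IsCartan (H : Submodule K A) : Prop :=
  IsSubalg mul H ∧ IsNilpotentSubalg mul H ∧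
    ∀ x : A, (∀ h ∈ H, mul x h ∈ H ∧ mul h x ∈ H) → x ∈ H

end Leib

namespace Leib

section Operators

open Polynomial

variable {K : Type*} [Field K] {V : Type*} [AddCommGroup V] [Module K V]

/-- If `[f, g]` commutes with `f`, then `[p(f), g] = p'(f) [f, g]`. -/
theorem aeval_commutator {f g : Module.End K V}
    (h : Commute f (f * g - g * f)) (p : K[X]) :
    aeval f p * g - g * aeval f p = aeval f (derivative p) * (f * g - g * f) := by
  induction p using Polynomial.induction_on' with
  | add p q hp hq =>
    simp only [map_add, add_mul, mul_add, ← hp, ← hq]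
    abel
  | monomial n a =>
    have hpow : ∀ n : ℕ, f ^ n * g - g * f ^ n = (n : K) • (f ^ (n - 1) * (f * g - g * f)) := by
      intro n
      induction n with
      | zero => simp
      | succ n ih =>
        have h1 : f ^ (n + 1) * g - g * f ^ (n + 1)
            = f ^ n * (f * g - g * f) + (f ^ n * g - g * f ^ n) * f := by
          rw [pow_succ]; noncomm_ring
        rw [h1, ih, smul_mul_assoc, mul_assoc, ← h.eq, ← mul_assoc, ← pow_succ]
        rcases n with _ | n
        · simp
        · simp only [Nat.add_sub_cancel, Nat.cast_succ, add_smul, one_smul]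
          abel
    simp only [derivative_monomial, aeval_monomial, ← Algebra.smul_def, smul_mul_assoc,
      mul_smul_comm, ← smul_sub, hpow, smul_smul]

/-- Over a perfect field, a semisimple operator commuting with `[f, g]` commutes with `g`. -/
theorem commute_of_commute_commutator [PerfectField K] [FiniteDimensional K V]
    {f g : Module.End K V} (hf : f.IsSemisimple) (h : Commute f (f * g - g * f)) :
    f * g - g * f = 0 := by
  have hsep : (minpoly K f).Separable :=
    PerfectField.separable_iff_squarefree.mpr hf.minpoly_squarefree
  obtain ⟨a, b, hab⟩ := hsep
  have h0 : aeval f (derivative (minpoly K f)) * (f * g - g * f) = 0 := by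
    rw [← aeval_commutator h, minpoly.aeval]; simp
  have h1 : aeval f b * aeval f (derivative (minpoly K f)) = 1 := by
    simpa using congrArg (aeval f) hab
  rw [← one_mul (f * g - g * f), ← h1, mul_assoc, h0, mul_zero]

end Operators

variable {K : Type*} [Field K] {A : Type*} [AddCommGroup A] [Module K A]
variable {mul : A →ₗ[K] A →ₗ[K] A}

theorem IsLeibniz.mul_mul (hleib : IsLeibniz mul) (x y z : A) :
    mul (mul x y) z = mul x (mul y z) - mul y (mul x z) :=
  eq_sub_of_add_eq (hleib x y z).symm

theorem mul_mem_prodSM {B C : Submodule K A} {b c : A} (hb : b ∈ B) (hc : c ∈ C) :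
    mul b c ∈ prodSM mul B C :=
  Submodule.subset_span ⟨b, hb, c, hc, rfl⟩

theorem prodSM_le {B C D : Submodule K A} (h : ∀ b ∈ B, ∀ c ∈ C, mul b c ∈ D) :
    prodSM mul B C ≤ D := by
  refine Submodule.span_le.mpr ?_
  rintro _ ⟨b, hb, c, hc, rfl⟩
  exact h b hb c hc

theorem IsIdeal.isSubalg {B : Submodule K A} (hB : IsIdeal mul B) : IsSubalg mul B :=
  fun x _ y hy => (hB x y hy).1

theorem IsIdeal.prodSM_self (hleib : IsLeibniz mul) {B : Submodule K A}
    (hB : IsIdeal mul B) : IsIdeal mul (prodSM mul B B) := by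
  intro a b hb
  constructor
  · refine (prodSM_le (D := (prodSM mul B B).comap (mul a)) ?_) hb
    intro x hx y hy
    rw [Submodule.mem_comap, hleib]
    exact add_mem (mul_mem_prodSM (hB a x hx).1 hy) (mul_mem_prodSM hx (hB a y hy).1)
  · refine (prodSM_le (D := (prodSM mul B B).comap (mul.flip a)) ?_) hb
    intro x hx y hy
    rw [Submodule.mem_comap, LinearMap.flip_apply, hleib.mul_mul x y a]
    exact sub_mem (mul_mem_prodSM hx (hB a y hy).2) (mul_mem_prodSM hy (hB a x hx).2)

theorem isIdeal_derOf_top (hleib : IsLeibniz mul) (n : ℕ) :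
    IsIdeal mul (derOf mul ⊤ n) := by
  induction n with
  | zero => intro a b _; simp [derOf]
  | succ n ih => exact ih.prodSM_self hleib

theorem derOf_add_eq_bot {B : Submodule K A} {m : ℕ} (hm : derOf mul B m = ⊥) (l : ℕ) :
    derOf mul B (m + l) = ⊥ := by
  induction l with
  | zero => exact hm
  | succ l ih =>
    rw [← add_assoc, derOf, ih, eq_bot_iff]
    exact prodSM_le fun b hb c _ => by simp [(Submodule.mem_bot K).mp hb]

/-- In an elementary algebra every ideal of a subalgebra is complemented by a
subalgebra. -/
theorem exists_complement [FiniteDimensional K A] (helem : IsElementary mul)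
    {M V : Submodule K A} (hM : IsSubalg mul M) (hV : IsIdealIn mul M V) :
    ∃ C : Submodule K A, IsSubalg mul C ∧ V ⊔ C = M ∧ V ⊓ C = ⊥ := by
  obtain ⟨C, ⟨hC, hVC⟩, hmin⟩ := WellFounded.has_min
    (wellFounded_lt : WellFounded ((· < ·) : Submodule K A → Submodule K A → Prop))
    {C | IsSubalg mul C ∧ V ⊔ C = M} ⟨M, hM, sup_eq_right.mpr hV.1⟩
  refine ⟨C, hC, hVC, ?_⟩
  have hCM : C ≤ M := hVC ▸ le_sup_right
  rw [eq_bot_iff, ← helem C hC]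
  have hideal : IsIdealIn mul C (V ⊓ C) := by
    refine ⟨inf_le_right, fun x hx c hc => ?_⟩
    exact ⟨⟨(hV.2 x (hCM hx) c hc.1).1, hC x hx c hc.2⟩,
      ⟨(hV.2 x (hCM hx) c hc.1).2, hC c hc.2 x hx⟩⟩
  refine le_sSup ⟨hideal, le_inf inf_le_right (le_sInf ?_)⟩
  rintro S ⟨hSC, hS, hne, hmax⟩
  have hsub : IsSubalg mul (V ⊓ C ⊔ S) := by
    intro x hx y hy
    obtain ⟨v, hv, s, hs, rfl⟩ := Submodule.mem_sup.mp hx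
    obtain ⟨w, hw, t, ht, rfl⟩ := Submodule.mem_sup.mp hy
    simp only [map_add, LinearMap.add_apply, add_assoc]
    have h1 := (hideal.2 w hw.2 v hv).2
    have h2 := (hideal.2 s (hSC hs) w hw).1
    have h3 := (hideal.2 t (hSC ht) v hv).2
    rw [← add_assoc]
    exact add_mem (Submodule.mem_sup_left (add_mem h1 h2))
      (add_mem (Submodule.mem_sup_left h3) (Submodule.mem_sup_right (hS s hs t ht)))
  rcases hmax _ (sup_le inf_le_right hSC) hsub le_sup_right with h | h
  · exact sup_eq_right.mp h
  · refine absurd (lt_of_le_of_ne hSC hne) (hmin S ⟨hS, ?_⟩)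
    rw [← hVC, ← h, ← sup_assoc, sup_inf_self]

/-- Left multiplication restricted to an ideal. -/
def leftMulOn {J : Submodule K A} (hJ : IsIdeal mul J) : A →ₗ[K] Module.End K J where
  toFun x := (mul x).restrict fun j hj => (hJ x j hj).1
  map_add' x y := by ext; simp
  map_smul' c x := by ext; simp

theorem leftMulOn_mul (hleib : IsLeibniz mul) {J : Submodule K A} (hJ : IsIdeal mul J)
    (x y : A) : leftMulOn hJ (mul x y) =
      leftMulOn hJ x * leftMulOn hJ y - leftMulOn hJ y * leftMulOn hJ x := by
  ext j
  simp [leftMulOn, hleib x y j]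

theorem isSemisimple_leftMulOn [FiniteDimensional K A] (hleib : IsLeibniz mul)
    (helem : IsElementary mul) {J : Submodule K A} (hJ : IsIdeal mul J)
    (hab : IsAbelian mul J) (ε : K) (hε : ∀ j ∈ J, ∀ x, mul j x = ε • mul x j) (x : A) :
    (leftMulOn hJ x).IsSemisimple := by
  rw [Module.End.isSemisimple_iff]
  intro p hp
  set W : Submodule K A := p.map J.subtype with hW
  have hWJ : W ≤ J := Submodule.map_subtype_le J p
  let M : Submodule K A :=
    { carrier := {y | ∀ w ∈ W, mul y w ∈ W}
      add_mem' := fun ha hb w hw => by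
        rw [map_add, LinearMap.add_apply]; exact add_mem (ha w hw) (hb w hw)
      zero_mem' := fun w _ => by simp
      smul_mem' := fun c a ha w hw => by
        rw [map_smul, LinearMap.smul_apply]; exact W.smul_mem c (ha w hw) }
  have hM : IsSubalg mul M := by
    intro y hy z hz w hw
    rw [hleib.mul_mul y z w]
    exact sub_mem (hy _ (hz w hw)) (hz _ (hy w hw))
  have hJM : J ≤ M := fun j hj w hw => by
    rw [hab j hj w (hWJ hw)]; exact zero_mem W
  have hxM : x ∈ M := by
    rintro _ ⟨w, hw, rfl⟩
    exact ⟨leftMulOn hJ x w, hp hw, rfl⟩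
  obtain ⟨C, hC, hsup, hinf⟩ := exists_complement helem hM (V := W)
    ⟨hWJ.trans hJM, fun y hy w hw => ⟨hy w hw, by
      rw [hε w (hWJ hw)]; exact W.smul_mem ε (hy w hw)⟩⟩
  refine ⟨C.comap J.subtype, ?_, ?_⟩
  · intro j hj
    rw [← hsup] at hxM
    obtain ⟨w, hw, c, hc, rfl⟩ := Submodule.mem_sup.mp hxM
    change mul (w + c) j ∈ C
    rw [map_add, LinearMap.add_apply, hab w (hWJ hw) j j.2, zero_add]
    exact hC c hc j hj
  · rw [isCompl_iff, Submodule.disjoint_def, codisjoint_iff, eq_top_iff]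
    constructor
    · intro j hj hjC
      have : (j : A) ∈ W ⊓ C := ⟨⟨j, hj, rfl⟩, hjC⟩
      rw [hinf] at this
      exact Subtype.ext this
    · intro j _
      have hj := hJM j.2
      rw [← hsup] at hj
      obtain ⟨_, ⟨w, hw, rfl⟩, c, hc, hwc⟩ := Submodule.mem_sup.mp hj
      have hcJ : c ∈ J := by
        rw [eq_sub_of_add_eq' hwc]; exact sub_mem j.2 w.2
      exact Submodule.mem_sup.mpr ⟨w, hw, ⟨c, hcJ⟩, hc, Subtype.ext hwc⟩

theorem leftMulOn_derOf_eq_zero [PerfectField K] [FiniteDimensional K A]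
    (hleib : IsLeibniz mul) (hsolv : IsSolvableAlg mul) (helem : IsElementary mul)
    {J : Submodule K A} (hJ : IsIdeal mul J) (hab : IsAbelian mul J) (ε : K)
    (hε : ∀ j ∈ J, ∀ x, mul j x = ε • mul x j) (n : ℕ) :
    ∀ x ∈ derOf mul ⊤ (n + 1), leftMulOn hJ x = 0 := by
  have hss := isSemisimple_leftMulOn hleib helem hJ hab ε hε
  have hstep : ∀ x y, Commute (leftMulOn hJ x) (leftMulOn hJ (mul x y)) →
      leftMulOn hJ (mul x y) = 0 := by
    intro x y h
    rw [leftMulOn_mul hleib] at h ⊢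
    exact commute_of_commute_commutator (hss x) h
  have hcomm : ∀ x y, leftMulOn hJ (mul x y) = 0 →
      Commute (leftMulOn hJ x) (leftMulOn hJ y) := by
    intro x y h
    rw [leftMulOn_mul hleib] at h
    exact sub_eq_zero.mp h
  have hdown : ∀ n, (∀ x ∈ derOf mul ⊤ (n + 2), leftMulOn hJ x = 0) →
      ∀ x ∈ derOf mul ⊤ (n + 1), leftMulOn hJ x = 0 := by
    intro n ih
    have hI := isIdeal_derOf_top hleib (n + 1)
    have hcentral : ∀ x ∈ derOf mul ⊤ (n + 1), ∀ z,
        Commute (leftMulOn hJ x) (leftMulOn hJ z) := fun x hx z =>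
      hcomm x z (hstep x z (hcomm _ _ (ih _ (mul_mem_prodSM hx (hI z x hx).2))))
    have hle : derOf mul ⊤ (n + 1) ≤ LinearMap.ker (leftMulOn hJ) :=
      prodSM_le fun x hx y hy => hstep x y (hcentral _ (mul_mem_prodSM hx hy) x).symm
    exact hle
  obtain ⟨m, hm⟩ := hsolv
  have hall : ∀ k n, m ≤ n + 1 + k → ∀ x ∈ derOf mul ⊤ (n + 1), leftMulOn hJ x = 0 := by
    intro k
    induction k with
    | zero =>
      intro n hn x hx
      obtain ⟨l, hl⟩ := Nat.exists_eq_add_of_le hn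
      rw [add_zero] at hl
      rw [hl, derOf_add_eq_bot hm, Submodule.mem_bot] at hx
      rw [hx, map_zero]
    | succ k ih => exact fun n hn => hdown n (ih (n + 1) (by omega))
  exact hall m n (by omega)

/-- In a solvable elementary algebra over a perfect field, the derived algebra annihilates every
abelian ideal from the left. -/
theorem derOf_mul_abelian_eq_zero [PerfectField K] [FiniteDimensional K A]
    (hleib : IsLeibniz mul) (hsolv : IsSolvableAlg mul) (helem : IsElementary mul)
    {J : Submodule K A} (hJ : IsIdeal mul J) (hab : IsAbelian mul J) (n : ℕ)
    {x : A} (hx : x ∈ derOf mul ⊤ (n + 1)) {j : A} (hj : j ∈ J) : mul x j = 0 := by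
  let J₀ : Submodule K A := J ⊓ LinearMap.ker mul
  have hJ₀ : IsIdeal mul J₀ := by
    rintro a b ⟨hb, hb0⟩
    have hb0' : mul b = 0 := hb0
    refine ⟨⟨(hJ a b hb).1, ?_⟩, by simp [hb0']⟩
    refine LinearMap.ext fun z => ?_
    rw [hleib.mul_mul a b z]
    simp [hb0']
  obtain ⟨C, hC, hsup, hinf⟩ := exists_complement helem (M := ⊤) (V := J₀)
    (fun _ _ _ _ => trivial) ⟨le_top, fun x _ c hc => hJ₀ x c hc⟩
  let D : Submodule K A := J ⊓ C
  have hD : IsIdeal mul D := by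
    rintro a b ⟨hb, hbC⟩
    refine ⟨⟨(hJ a b hb).1, ?_⟩, ⟨(hJ a b hb).2, ?_⟩⟩ <;>
    · obtain ⟨w, hw, c, hc, rfl⟩ := Submodule.mem_sup.mp (hsup ▸ Submodule.mem_top : a ∈ J₀ ⊔ C)
      simp only [map_add, LinearMap.add_apply, hab w hw.1 b hb, hab b hb w hw.1, zero_add]
      first | exact hC c hc b hbC | exact hC b hbC c hc
  have hzero : ∀ {I : Submodule K A} (hI : IsIdeal mul I), I ≤ J → ∀ ε : K,
      (∀ i ∈ I, ∀ x, mul i x = ε • mul x i) → ∀ i ∈ I, mul x i = 0 := by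
    intro I hI hle ε hε i hi
    have := leftMulOn_derOf_eq_zero hleib hsolv helem hI
      (fun a ha b hb => hab a (hle ha) b (hle hb)) ε hε n x hx
    exact congrArg Subtype.val (LinearMap.congr_fun this ⟨i, hi⟩)
  obtain ⟨w, hw, c, hc, rfl⟩ := Submodule.mem_sup.mp (hsup ▸ Submodule.mem_top : j ∈ J₀ ⊔ C)
  have hcJ : c ∈ J := by simpa using sub_mem hj hw.1
  have hskew : ∀ d ∈ D, ∀ y, mul d y = (-1 : K) • mul y d := by
    intro d hd y
    have hmem : mul d y + mul y d ∈ J₀ ⊓ C := by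
      have h := add_mem (hD y d hd).2 (hD y d hd).1
      refine ⟨⟨h.1, LinearMap.ext fun z => ?_⟩, h.2⟩
      rw [map_add, LinearMap.add_apply, hleib.mul_mul d y z, hleib.mul_mul y d z]
      simp
    rw [hinf, Submodule.mem_bot] at hmem
    rw [neg_one_smul]
    exact eq_neg_of_add_eq_zero_left hmem
  have hannih : ∀ i ∈ J₀, ∀ y, mul i y = (0 : K) • mul y i := fun i hi y => by
    simp [show mul i = 0 from hi.2]
  rw [map_add, hzero hJ₀ inf_le_left 0 hannih w hw,
    hzero hD inf_le_left (-1) hskew c ⟨hcJ, hc⟩, add_zero]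

/-- In an elementary algebra, a subalgebra `B` with `B (B B) = 0` is abelian. -/
theorem prodSM_self_eq_bot [FiniteDimensional K A] (hleib : IsLeibniz mul)
    (helem : IsElementary mul) {B : Submodule K A} (hB : IsSubalg mul B)
    (h : ∀ b ∈ B, ∀ d ∈ prodSM mul B B, mul b d = 0) : prodSM mul B B = ⊥ := by
  have hle : prodSM mul B B ≤ B := prodSM_le hB
  have hright : ∀ b ∈ B, ∀ d ∈ prodSM mul B B, mul d b = 0 := by
    intro b hb
    refine fun d hd => (prodSM_le (D := LinearMap.ker (mul.flip b)) ?_) hd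
    intro x hx y hy
    rw [LinearMap.mem_ker, LinearMap.flip_apply, hleib.mul_mul x y b,
      h x hx _ (mul_mem_prodSM hy hb), h y hy _ (mul_mem_prodSM hx hb), sub_zero]
  obtain ⟨C, hC, hsup, hinf⟩ := exists_complement helem hB (V := prodSM mul B B)
    ⟨hle, fun x hx c hc => by simp [h x hx c hc, hright x hx c hc]⟩
  rw [eq_bot_iff, ← hinf]
  refine le_inf le_rfl (prodSM_le fun x hx y hy => ?_)
  have hy' := hy
  rw [← hsup] at hx hy'
  obtain ⟨d, hd, c, hc, rfl⟩ := Submodule.mem_sup.mp hx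
  obtain ⟨d', hd', c', hc', rfl⟩ := Submodule.mem_sup.mp hy'
  have hcB : c ∈ B := hsup ▸ Submodule.mem_sup_right hc
  rw [map_add mul, LinearMap.add_apply, hright _ hy d hd, zero_add, map_add, h c hcB d' hd', zero_add]
  exact hC c hc c' hc'

end Leib

open Leib

variable {K : Type*} [Field K] {A : Type*} [AddCommGroup A] [Module K A]
variable (mul : A →ₗ[K] A →ₗ[K] A)

/-- A finite-dimensional solvable elementary Leibniz algebra over a perfect field
has nilpotent derived algebra. -/
theorem stmt18 [PerfectField K] [FiniteDimensional K A]
    (hleib : IsLeibniz mul) (hsolv : IsSolvableAlg mul)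
    (helem : IsElementary mul) :
    IsNilpotentSubalg mul (derivedSubalg mul) := by
  obtain ⟨m, hm⟩ := id hsolv
  have hdown : ∀ n, derOf mul ⊤ (n + 3) = ⊥ → derOf mul ⊤ (n + 2) = ⊥ := by
    intro n hn
    have hab : IsAbelian mul (derOf mul ⊤ (n + 2)) := fun x hx y hy =>
      (Submodule.mem_bot K).mp (hn ▸ mul_mem_prodSM hx hy)
    exact prodSM_self_eq_bot hleib helem (isIdeal_derOf_top hleib (n + 1)).isSubalg
      fun b hb d hd => derOf_mul_abelian_eq_zero hleib hsolv helem
        (isIdeal_derOf_top hleib (n + 2)) hab n hb hd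
  have hall : ∀ n, derOf mul ⊤ (n + 2) = ⊥ → derOf mul ⊤ 2 = ⊥ := by
    intro n
    induction n with
    | zero => exact id
    | succ n ih => exact fun h => ih (hdown n h)
  exact ⟨1, hall m (derOf_add_eq_bot hm 2)⟩
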